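/- For every integer b ≥ 3, there are only finitely many base-b rep-digits, i.e., positive integers of the form a·(b^n − 1)/(b − 1) with a ∈ {1,...,b−1} and n ≥ 2, that are base-b Keith numbers. -/

import Mathlib

/-- `keithList a m` is the list of the first `m` terms `K^N_1, …, K^N_m` of the Keith
sequence associated with the digit string `a = [a_1, …, a_n]` (most significant first):
`K^N_m = a_m` for `1 ≤ m ≤ n` and `K^N_m = K^N_{m-1} + ⋯ + K^N_{m-n}` for `m > n`. -/
def keithList (a : List ℕ) : ℕ → List ℕ
  | 0 => []
  | m + 1 =>
      let prev := keithList a m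
      prev ++ [if m < a.length then a.getD m 0 else (prev.drop (m - a.length)).sum]

/-- `keithSeq a m = K^N_m` (1-indexed; `keithSeq a 0 = 0` by convention). -/
def keithSeq (a : List ℕ) (m : ℕ) : ℕ := (keithList a m).getD (m - 1) 0

/-- A base-b Keith number: a positive integer with at least 2 base-b digits that occurs
in the Keith sequence generated by its own base-b digits (most significant first). -/
def IsKeithBase (b N : ℕ) : Prop :=
  2 ≤ (Nat.digits b N).length ∧
    ∃ m, 1 ≤ m ∧ keithSeq ((Nat.digits b N).reverse) m = N

theorem ofDigits_replicate_eq_mul_geomSum (b a n : ℕ) :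
    Nat.ofDigits b (List.replicate n a) = a * ∑ i ∈ Finset.range n, b ^ i := by
  induction n with
  | zero => simp
  | succ n ih =>
    rw [List.replicate_succ, Nat.ofDigits_cons, ih, Finset.sum_range_succ']
    simp only [pow_succ, ← Finset.sum_mul, pow_zero]
    ring

theorem digits_repdigit {b a n : ℕ} (hb : 2 ≤ b) (ha : 1 ≤ a) (hab : a ≤ b - 1) :
    Nat.digits b (a * ((b ^ n - 1) / (b - 1))) = List.replicate n a := by
  rw [← Nat.geomSum_eq hb, ← ofDigits_replicate_eq_mul_geomSum]
  apply Nat.digits_ofDigits b (by omega)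
  · intro l hl
    have := List.eq_of_mem_replicate hl
    omega
  · intro h
    rw [List.getLast_replicate]
    omega

theorem keithList_length (a : List ℕ) (m : ℕ) : (keithList a m).length = m := by
  induction m with
  | zero => rfl
  | succ m ih => simp [keithList, ih]

theorem keithSeq_succ (a : List ℕ) (m : ℕ) : keithSeq a (m + 1) =
    if m < a.length then a.getD m 0 else ((keithList a m).drop (m - a.length)).sum := by
  have h := keithList_length a m
  simp [keithSeq, keithList, h]

theorem sum_drop_keithList (a : List ℕ) (m k : ℕ) (hk : k ≤ m) :
    ((keithList a m).drop k).sum = ∑ i ∈ Finset.Ico k m, keithSeq a (i + 1) := by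
  induction m, hk using Nat.le_induction with
  | base => simp [List.drop_eq_nil_of_le (keithList_length a k).le]
  | succ m hm ih =>
    rw [Finset.sum_Ico_succ_top hm, ← ih, keithSeq_succ, keithList,
      List.drop_append_of_le_length (by rw [keithList_length]; exact hm)]
    simp

theorem keithSeq_add_length_succ (a : List ℕ) (k : ℕ) :
    keithSeq a (a.length + k + 1) =
      ∑ i ∈ Finset.Ico k (a.length + k), keithSeq a (i + 1) := by
  rw [keithSeq_succ, if_neg (by omega), Nat.add_sub_cancel_left, sum_drop_keithList _ _ _ (by omega)]

theorem keithSeq_replicate_of_lt {n a i : ℕ} (hi : i < n) :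
    keithSeq (List.replicate n a) (i + 1) = a := by
  rw [keithSeq_succ, if_pos (by simpa using hi)]
  simp [hi]

/-- The coefficients of the power series `1 / (1 - 2x + x ^ (n + 1))`. -/
def delayedDoubling (n : ℕ) : ℕ → ℤ
  | 0 => 1
  | m + 1 => 2 * delayedDoubling n m - if n ≤ m then delayedDoubling n (m - n) else 0

theorem delayedDoubling_zero (n : ℕ) : delayedDoubling n 0 = 1 := by
  rw [delayedDoubling]

theorem delayedDoubling_succ (n m : ℕ) : delayedDoubling n (m + 1) =
    2 * delayedDoubling n m - if n ≤ m then delayedDoubling n (m - n) else 0 := by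
  rw [delayedDoubling]

theorem keithSeq_replicate {n : ℕ} (hn : 1 ≤ n) (a k : ℕ) :
    (keithSeq (List.replicate n a) (n + k + 1) : ℤ) =
      a * (1 + (n - 1) * delayedDoubling n k) := by
  have hrec : ∀ j, keithSeq (List.replicate n a) (n + j + 1) =
      ∑ i ∈ Finset.Ico j (n + j), keithSeq (List.replicate n a) (i + 1) := fun j => by
    simpa using keithSeq_add_length_succ (List.replicate n a) j
  induction k using Nat.strong_induction_on with
  | _ k ih =>
    rcases k with _ | k
    · rw [hrec 0, delayedDoubling_zero, Finset.sum_congr rfl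
        fun i hi => keithSeq_replicate_of_lt (by simpa using hi)]
      simp
      ring
    · have hk := ih k (by omega)
      have h1 := hrec k
      have h2 := hrec (k + 1)
      rw [← add_assoc, Finset.sum_Ico_succ_top (by omega)] at h2
      rw [Finset.sum_eq_sum_Ico_succ_bot (by omega)] at h1
      have h3 : (keithSeq (List.replicate n a) (n + k + 1 + 1) : ℤ) =
          2 * keithSeq (List.replicate n a) (n + k + 1) -
            keithSeq (List.replicate n a) (k + 1) := by
        omega
      rw [← add_assoc, h3, hk, delayedDoubling_succ]
      split_ifs with h
      · have := ih (k - n) (by omega)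
        rw [show n + (k - n) = k by omega] at this
        rw [this]
        ring
      · rw [keithSeq_replicate_of_lt (by omega)]
        ring

theorem delayedDoubling_mono_pos (n m : ℕ) :
    0 < delayedDoubling n m ∧ ∀ k ≤ m, delayedDoubling n k ≤ delayedDoubling n m := by
  induction m with
  | zero => simp [delayedDoubling_zero]
  | succ m ih =>
    obtain ⟨hpos, hle⟩ := ih
    have hstep : delayedDoubling n m ≤ delayedDoubling n (m + 1) := by
      rw [delayedDoubling_succ]
      split_ifs
      · linarith [hle (m - n) (by omega)]
      · linarith
    refine ⟨by linarith, fun k hk => ?_⟩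
    rcases Nat.le_succ_iff.mp hk with h | rfl
    · exact (hle k h).trans hstep
    · rfl

theorem delayedDoubling_pos (n m : ℕ) : 0 < delayedDoubling n m :=
  (delayedDoubling_mono_pos n m).1

theorem delayedDoubling_mono (n : ℕ) : Monotone (delayedDoubling n) :=
  fun k m h => (delayedDoubling_mono_pos n m).2 k h

theorem delayedDoubling_le_two_pow (n m : ℕ) : delayedDoubling n m ≤ 2 ^ m := by
  induction m with
  | zero => simp [delayedDoubling_zero]
  | succ m ih =>
    rw [delayedDoubling_succ, pow_succ]
    split_ifs
    · linarith [delayedDoubling_pos n (m - n)]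
    · linarith

theorem two_pow_mul_le_delayedDoubling (n m : ℕ) :
    2 ^ m * (2 ^ (n + 1) - m : ℤ) ≤ 2 ^ (n + 1) * delayedDoubling n m := by
  induction m with
  | zero => simp [delayedDoubling_zero]
  | succ m ih =>
    have h : (2 : ℤ) ^ (n + 1) * (if n ≤ m then delayedDoubling n (m - n) else 0) ≤
        2 ^ (m + 1) := by
      split_ifs with h
      · calc (2 : ℤ) ^ (n + 1) * delayedDoubling n (m - n) ≤ 2 ^ (n + 1) * 2 ^ (m - n) := by
              gcongr
              exact delayedDoubling_le_two_pow _ _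
          _ = 2 ^ (m + 1) := by
              rw [← pow_add]
              congr 1
              omega
      · positivity
    rw [delayedDoubling_succ, mul_sub]
    push_cast
    linear_combination 2 * ih + h

theorem two_pow_dvd_delayedDoubling (n q r : ℕ) (hr : r ≤ n) :
    2 ^ r ∣ delayedDoubling n ((n + 1) * q + r) := by
  induction q generalizing r with
  | zero =>
    induction r with
    | zero => simp
    | succ r ih =>
      rw [← add_assoc, delayedDoubling_succ, if_neg (by omega), sub_zero, pow_succ']
      exact mul_dvd_mul_left _ (ih (by omega))
  | succ q ihq =>
    induction r with
    | zero => simp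
    | succ r ih =>
      rw [← add_assoc, delayedDoubling_succ, if_pos (by rw [mul_add]; omega)]
      apply dvd_sub
      · rw [pow_succ']
        exact mul_dvd_mul_left _ (ih (by omega))
      · rw [show (n + 1) * (q + 1) + r - n = (n + 1) * q + (r + 1) by rw [mul_add]; omega]
        exact ihq (r + 1) hr

/-- The `2`-adic valuation of the cofactor of `t * (b - 1)` in `b ^ (t + 1) - b` is bounded
independently of `t`. -/
theorem le_of_two_pow_dvd_of_mul_eq {b t g r : ℕ} (hb : 3 ≤ b) (ht : 1 ≤ t)
    (hg : 0 < g) (h : t * (b - 1) * g = b * (b ^ t - 1)) (hr : 2 ^ r ∣ g) : r ≤ b := by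
  have hbt : b ≤ b ^ t := Nat.le_self_pow (by omega) b
  rcases Nat.even_or_odd b with he | ho
  · have hcop : Nat.Coprime (2 ^ r) (b ^ t - 1) := by
      apply Nat.Coprime.pow_left
      rw [Nat.coprime_two_left]
      have : Even (b ^ t) := he.pow_of_ne_zero (by omega)
      exact Nat.Even.sub_odd (by omega) this odd_one
    have hd : 2 ^ r ∣ b := hcop.dvd_of_dvd_mul_right (h ▸ hr.mul_left _)
    exact (Nat.lt_two_pow_self.trans_le (Nat.le_of_dvd (by omega) hd)).le
  · have hv := congrArg (padicValNat 2) h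
    have hb1 : b - 1 ≠ 0 := by omega
    have hbt1 : b ^ t - 1 ≠ 0 := by omega
    have hlt : padicValNat 2 (b ^ t - 1) ≤ padicValNat 2 (b ^ (2 * t) - 1) := by
      have hlt' : b ^ t < b ^ (2 * t) := Nat.pow_lt_pow_right (by omega) (by omega)
      rw [← padicValNat_dvd_iff_le (by omega)]
      refine pow_padicValNat_dvd.trans ?_
      have := Nat.sub_dvd_pow_sub_pow (b ^ t) 1 2
      rwa [one_pow, ← pow_mul, mul_comm t] at this
    have hl := padicValNat.pow_two_sub_pow (x := b) (y := 1) (by omega)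
      (by obtain ⟨c, rfl⟩ := ho; omega) (by obtain ⟨c, rfl⟩ := ho; omega)
      (n := 2 * t) (by omega) (even_two_mul t)
    rw [one_pow, padicValNat.mul (by omega) (by omega), padicValNat_self] at hl
    rw [padicValNat.mul (by positivity) (by omega), padicValNat.mul (by omega) hb1,
      padicValNat.mul (by omega) hbt1,
      padicValNat.eq_zero_of_not_dvd (n := b) (by obtain ⟨c, rfl⟩ := ho; omega)] at hv
    have hrg := (padicValNat_dvd_iff_le (by omega)).mp hr
    have hlog := (padicValNat_le_nat_log (p := 2) (b + 1)).trans_lt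
      (Nat.log_lt_self 2 (by omega : b + 1 ≠ 0))
    omega

theorem eventually_mul_pow_lt_pow (C : ℕ) {c b : ℕ} (hcb : c < b) :
    ∀ᶠ n : ℕ in Filter.atTop, C * n * c ^ n < b ^ n := by
  have hb : (0 : ℝ) < b := by exact_mod_cast (by omega : 0 < b)
  have hlt : (c / b : ℝ) < 1 := by
    rw [div_lt_one hb]
    exact_mod_cast hcb
  have h := (tendsto_self_mul_const_pow_of_lt_one (by positivity) hlt).const_mul (C : ℝ)
  rw [mul_zero] at h
  filter_upwards [h.eventually_lt_const one_pos] with n hn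
  have hbn : (0 : ℝ) < (b : ℝ) ^ n := by positivity
  rw [div_pow, ← mul_assoc, ← mul_div_assoc, div_lt_one hbn] at hn
  exact_mod_cast hn

theorem eventually_sub_one_mul_ne_pow_sub {b : ℕ} (hb : 3 ≤ b) :
    ∀ᶠ n : ℕ in Filter.atTop, ∀ k : ℕ,
      ((n : ℤ) - 1) * (b - 1) * delayedDoubling n k ≠ b ^ n - b := by
  have e1 := eventually_mul_pow_lt_pow (2 * b) (c := 1) (b := 2) (by norm_num)
  have e2 := eventually_mul_pow_lt_pow (b * (b - 1) * 2 ^ b) (c := b - 1) (b := b) (by omega)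
  filter_upwards [e1, e2, Filter.eventually_ge_atTop 2] with n h1 h2 hn k heq
  obtain ⟨t, rfl⟩ : ∃ t, n = t + 1 := ⟨n - 1, by omega⟩
  have hb3 : (3 : ℤ) ≤ b := by exact_mod_cast hb
  have ht1 : (1 : ℤ) ≤ t := by exact_mod_cast (by omega : 1 ≤ t)
  push_cast at heq
  rw [add_sub_cancel_right] at heq
  set n := t + 1 with hnt
  set q := k / (n + 1) with hq
  set r := k % (n + 1) with hr
  have hk : (n + 1) * q + r = k := Nat.div_add_mod k (n + 1)
  have hrn : r ≤ n := Nat.lt_succ_iff.mp (Nat.mod_lt _ (by omega))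
  have hdvd := two_pow_dvd_delayedDoubling n q r hrn
  rw [hk] at hdvd
  have hGpos := delayedDoubling_pos n k
  have hrb : r ≤ b := by
    obtain ⟨g, hg⟩ := Int.eq_ofNat_of_zero_le hGpos.le
    rw [hg] at hdvd heq hGpos
    refine le_of_two_pow_dvd_of_mul_eq (t := t) (g := g) hb (by omega) (by omega) ?_
      (by exact_mod_cast hdvd)
    have hbt : 1 ≤ b ^ t := Nat.one_le_pow _ _ (by omega)
    zify [hbt, (by omega : 1 ≤ b)]
    rw [heq]
    ring
  by_cases hqb : 2 ^ q < b
  · have hup := delayedDoubling_le_two_pow n k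
    have hkpow : (2 : ℤ) ^ k ≤ (b - 1) ^ (n + 1) * 2 ^ b := by
      rw [← hk, pow_add, mul_comm (n + 1), pow_mul]
      have : (2 : ℤ) ^ q ≤ b - 1 := by
        have : (2 : ℤ) ^ q < b := by exact_mod_cast hqb
        linarith
      have hb0 : (0 : ℤ) ≤ b - 1 := by linarith
      gcongr
      norm_num
    zify [(by omega : 1 ≤ b)] at h2
    have hX : (1 : ℤ) ≤ (b - 1) ^ (n + 1) * 2 ^ b :=
      one_le_mul_of_one_le_of_one_le (one_le_pow₀ (by linarith)) (one_le_pow₀ (by norm_num))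
    have hG := mul_le_mul_of_nonneg_left (hup.trans hkpow)
      (by nlinarith : (0 : ℤ) ≤ t * (b - 1))
    have hnt' : (n : ℤ) = t + 1 := by rw [hnt]; push_cast; ring
    rw [pow_succ] at hX hG
    rw [hnt'] at h2
    nlinarith
  · have hqb : b ≤ 2 ^ min q b := by
      rcases min_choice q b with h | h <;> rw [h]
      · omega
      · exact Nat.lt_two_pow_self.le
    have hmk : (n + 1) * min q b ≤ k :=
      (Nat.mul_le_mul_left _ (min_le_left _ _)).trans (by omega)
    have hm : (n + 1) * min q b ≤ 2 ^ n := by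
      rw [one_pow, mul_one] at h1
      calc (n + 1) * min q b ≤ (2 * n) * b := Nat.mul_le_mul (by omega) (min_le_right _ _)
        _ = 2 * b * n := by ring
        _ ≤ 2 ^ n := h1.le
    have hlow := two_pow_mul_le_delayedDoubling n ((n + 1) * min q b)
    have hmono := delayedDoubling_mono n hmk
    have hpow : (b : ℤ) ^ n ≤ 2 ^ ((n + 1) * min q b) := by
      rw [mul_comm, pow_mul]
      exact_mod_cast (Nat.pow_le_pow_right (by omega) n.le_succ).trans
        (Nat.pow_le_pow_left hqb (n + 1))
    have hm' : (((n + 1) * min q b : ℕ) : ℤ) ≤ 2 ^ n := by exact_mod_cast hm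
    have h2G : (2 : ℤ) ^ ((n + 1) * min q b) ≤ 2 * delayedDoubling n ((n + 1) * min q b) := by
      refine le_of_mul_le_mul_left ?_ (by positivity : (0 : ℤ) < 2 ^ n)
      have := mul_le_mul_of_nonneg_left hm' (by positivity : (0 : ℤ) ≤ 2 ^ ((n + 1) * min q b))
      rw [pow_succ] at hlow
      linarith
    have h2t : 2 * delayedDoubling n k ≤ t * (b - 1) * delayedDoubling n k :=
      mul_le_mul_of_nonneg_right (by nlinarith) hGpos.le
    linarith

/-- For every b ≥ 3, only finitely many base-b rep-digits a·(b^n−1)/(b−1),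
a ∈ {1,…,b−1}, n ≥ 2, are base-b Keith numbers. -/
theorem keith_repdigits_finite_base (b : ℕ) (hb : 3 ≤ b) :
    {N : ℕ | (∃ a n : ℕ, 1 ≤ a ∧ a ≤ b - 1 ∧ 2 ≤ n ∧
        N = a * ((b ^ n - 1) / (b - 1))) ∧ IsKeithBase b N}.Finite := by
  obtain ⟨n₀, hn₀⟩ := Filter.eventually_atTop.mp (eventually_sub_one_mul_ne_pow_sub hb)
  refine (Set.finite_Iio (b ^ n₀)).subset ?_
  rintro N ⟨⟨a, n, ha, hab, hn, rfl⟩, -, m, hm, hK⟩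
  rw [Set.mem_Iio, ← Nat.digits_length_le_iff (by omega),
    digits_repdigit (by omega) ha hab, List.length_replicate]
  by_contra! hlt
  rw [digits_repdigit (by omega) ha hab, List.reverse_replicate] at hK
  have hgeom : (b - 1) * ((b ^ n - 1) / (b - 1)) = b ^ n - 1 :=
    Nat.mul_div_cancel' (by simpa using Nat.sub_dvd_pow_sub_pow b 1 n)
  have hbn : b ^ 2 ≤ b ^ n := Nat.pow_le_pow_right (by omega) hn
  generalize (b ^ n - 1) / (b - 1) = R at hgeom hK
  zify [(by omega : 1 ≤ b), Nat.one_le_pow n b (by omega)] at hgeom hbn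
  have hb3 : (3 : ℤ) ≤ b := by exact_mod_cast hb
  have ha0 : (a : ℤ) ≠ 0 := by exact_mod_cast (by omega : a ≠ 0)
  obtain ⟨i, rfl⟩ : ∃ i, m = i + 1 := ⟨m - 1, by omega⟩
  rcases lt_or_ge i n with hi | hi
  · rw [keithSeq_replicate_of_lt hi] at hK
    have hR : R = 1 := Nat.eq_of_mul_eq_mul_left (by omega : 0 < a) (by omega)
    subst hR
    push_cast at hgeom
    nlinarith
  · obtain ⟨k, rfl⟩ := Nat.exists_eq_add_of_le hi
    have hk := keithSeq_replicate (by omega : 1 ≤ n) a k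
    rw [hK] at hk
    push_cast at hk
    have hR := mul_left_cancel₀ ha0 hk
    refine hn₀ n hlt.le k ?_
    rw [hR] at hgeom
    linear_combination hgeom
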